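/- arXiv:1602.05081 — 3 statements merged into one kernel-verified Lean document; each statement's English description precedes it below -/
import Mathlib

section
/- If T is a half-centered bounded linear operator on a complex Hilbert space H whose range is dense in H, then T is centered. -/
open ContinuousLinearMap

variable {H : Type*} [NormedAddCommGroup H] [InnerProductSpace ℂ H] [CompleteSpace H]

noncomputable def opT (T : H →L[ℂ] H) (k : ℕ) : H →L[ℂ] H :=
  ContinuousLinearMap.adjoint (T ^ k) ∘L (T ^ k)

def IsHalfCentered (T : H →L[ℂ] H) : Prop :=
  ∀ j k : ℕ, opT T j ∘L opT T k = opT T k ∘L opT T j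

def IsCentered (T : H →L[ℂ] H) : Prop :=
  (∀ j k : ℕ, Commute ((T ^ j) ∘L ContinuousLinearMap.adjoint (T ^ j))
      ((T ^ k) ∘L ContinuousLinearMap.adjoint (T ^ k))) ∧
  (∀ j k : ℕ, Commute ((T ^ j) ∘L ContinuousLinearMap.adjoint (T ^ j))
      (ContinuousLinearMap.adjoint (T ^ k) ∘L (T ^ k))) ∧
  (∀ j k : ℕ, Commute (ContinuousLinearMap.adjoint (T ^ j) ∘L (T ^ j))
      (ContinuousLinearMap.adjoint (T ^ k) ∘L (T ^ k)))

/-- An operator `D` is determined by the compression `S† D S` when `S` has dense range. -/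
theorem eq_of_star_mul_mul_eq_of_denseRange {S D E : H →L[ℂ] H} (hS : DenseRange (S : H → H))
    (h : star S * D * S = star S * E * S) : D = E := by
  have hinj : ∀ F : H →L[ℂ] H, star S * F = 0 → F = 0 := by
    intro F hF
    have hF' : star F * S = 0 := by simpa using congrArg star hF
    have hstar : star F = 0 := by
      refine DFunLike.coe_injective (hS.equalizer (star F).continuous continuous_const ?_)
      funext x
      exact DFunLike.congr_fun hF' x
    simpa using hstar
  have hDS : (D - E) * S = 0 := hinj _ (by
    rw [sub_mul, mul_sub, ← mul_assoc, ← mul_assoc, h, sub_self])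
  refine DFunLike.coe_injective (hS.equalizer D.continuous E.continuous ?_)
  funext x
  exact sub_eq_zero.mp (DFunLike.congr_fun hDS x)

theorem denseRange_pow {E : Type*} [NormedAddCommGroup E] [NormedSpace ℂ E] {T : E →L[ℂ] E}
    (hd : DenseRange (T : E → E)) (n : ℕ) : DenseRange ((T ^ n : E →L[ℂ] E) : E → E) := by
  induction n with
  | zero => exact denseRange_id
  | succ n ih => rw [pow_succ]; exact ih.comp hd (T ^ n).continuous

theorem commute_pow_mul_star_pow_star_pow_mul_pow {T : H →L[ℂ] H}
    (hT : ∀ j k : ℕ, Commute (star (T ^ j) * T ^ j) (star (T ^ k) * T ^ k))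
    (hd : DenseRange (T : H → H)) (j k : ℕ) :
    Commute (T ^ j * star (T ^ j)) (star (T ^ k) * T ^ k) := by
  refine eq_of_star_mul_mul_eq_of_denseRange (denseRange_pow hd j) ?_
  have h := (hT j (k + j)).eq
  simp only [pow_add, star_mul] at h
  simpa only [mul_assoc] using h

theorem commute_pow_mul_star_pow_add {R : Type*} [Monoid R] [StarMul R] {T : R} {j m : ℕ}
    (h : Commute (T ^ m * star (T ^ m)) (star (T ^ j) * T ^ j)) :
    Commute (T ^ j * star (T ^ j)) (T ^ (j + m) * star (T ^ (j + m))) := by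
  have h' := congrArg (fun X => T ^ j * X * star (T ^ j)) h.eq
  simp only [mul_assoc] at h'
  simp only [Commute, SemiconjBy, pow_add, star_mul, mul_assoc, h']

/-- A half-centered operator with dense range is centered. -/
theorem halfCentered_denseRange_isCentered (T : H →L[ℂ] H) (hT : IsHalfCentered T)
    (hd : DenseRange (T : H → H)) : IsCentered T := by
  have hcomm : ∀ j k : ℕ, Commute (star (T ^ j) * T ^ j) (star (T ^ k) * T ^ k) := hT
  have hmixed := commute_pow_mul_star_pow_star_pow_mul_pow hcomm hd
  refine ⟨fun j k => ?_, hmixed, hcomm⟩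
  rcases le_total j k with h | h
  · obtain ⟨m, rfl⟩ := Nat.exists_eq_add_of_le h
    exact commute_pow_mul_star_pow_add (hmixed m j)
  · obtain ⟨m, rfl⟩ := Nat.exists_eq_add_of_le h
    exact (commute_pow_mul_star_pow_add (hmixed m k)).symm
end

section
/- Let K be a complex Hilbert space and let A be a commutative unital C*-subalgebra of the bounded operators on K (a norm-closed star subalgebra containing the identity whose elements pairwise commute), and let x ∈ K be a cyclic vector for A, i.e., {a x : a ∈ A} is dense in K. Then for any a₁, a₂ ∈ A and any character λ of A (a nonzero multiplicative linear functional on A), there exists a sequence (x_l) in K with ⟨x_l, x⟩ ≠ 0 for every l, such that for i = 1, 2: a_i x_l − λ(a_i) x_l → 0 in norm as l → ∞, and ⟨a_i x_l, x⟩ / ⟨x_l, x⟩ → λ(a_i) as l → ∞. -/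
open ContinuousLinearMap Filter
open scoped ComplexInnerProductSpace Topology

theorem IsSelfAdjoint.exists_sq_sub_sq {A : Type*} [CStarAlgebra A] {b : A}
    (hb : IsSelfAdjoint b) :
    ∃ s t : A, IsSelfAdjoint s ∧ IsSelfAdjoint t ∧ t * s = 0 ∧ s * s - t * t = b := by
  refine ⟨cfc (fun r : ℝ => √(max r 0)) b, cfc (fun r : ℝ => √(max (-r) 0)) b,
    cfc_predicate _ b, cfc_predicate _ b, ?_, ?_⟩
  · rw [← cfc_mul (fun r : ℝ => √(max (-r) 0)) (fun r : ℝ => √(max r 0)) b]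
    refine (cfc_congr fun r _ => ?_).trans (cfc_const_zero ℝ b)
    rcases le_total r 0 with h | h <;> simp [h]
  · rw [← cfc_mul .., ← cfc_mul .., ← cfc_sub ..]
    refine (cfc_congr fun r _ => ?_).trans (cfc_id ℝ b)
    rcases le_total r 0 with h | h <;> simp [h]

/-- Given two elements in the kernel of a character of a C⋆-algebra, there is a
self-adjoint `s` outside this kernel on which `ε - star u * u - star v * v` acts as `s * s`. -/
theorem AlgHom.exists_isSelfAdjoint_localizer {A : Type*} [CStarAlgebra A]
    (φ : A →ₐ[ℂ] ℂ) {u v : A} (hu : φ u = 0) (hv : φ v = 0) {ε : ℝ} (hε : 0 < ε) :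
    ∃ s : A, IsSelfAdjoint s ∧ φ s ≠ 0 ∧
      (star u * u + star v * v) * s = (ε : ℂ) • s - s * s * s := by
  have hb : IsSelfAdjoint ((ε : ℂ) • (1 : A) - (star u * u + star v * v)) := by
    simp [IsSelfAdjoint, star_smul]
  obtain ⟨s, t, hs, ht, hts, hst⟩ := hb.exists_sq_sub_sq
  refine ⟨s, hs, fun h0 => ?_, ?_⟩
  · have h1 := congrArg φ hst
    simp only [map_sub, map_add, map_mul, map_smul, map_one, hu, hv, h0] at h1
    have h2 := ht.mem_spectrum_eq_re (AlgHom.apply_mem_spectrum φ t)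
    rw [h2] at h1
    have h3 : -((φ t).re * (φ t).re) = ε := by
      have := congrArg Complex.re h1
      simpa using this
    nlinarith [mul_self_nonneg (φ t).re]
  · have h1 := congrArg (· * s) hst
    simp only [sub_mul, smul_mul_assoc, one_mul, mul_assoc t t s, hts, mul_zero, sub_zero] at h1
    rw [h1]
    abel

section

variable {K : Type*} [NormedAddCommGroup K] [InnerProductSpace ℂ K] [CompleteSpace K]

theorem ContinuousLinearMap.norm_sq_add_norm_sq_le_of_localizer {s u v : K →L[ℂ] K}
    (hs : IsSelfAdjoint s) {ε : ℝ}
    (h : (star u * u + star v * v) * s = (ε : ℂ) • s - s * s * s) (w : K) :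
    ‖u (s w)‖ ^ 2 + ‖v (s w)‖ ^ 2 ≤ ε * ‖s w‖ ^ 2 := by
  have hsym : ∀ a b : K, ⟪a, s b⟫ = ⟪s a, b⟫ := fun a b => (hs.isSymmetric a b).symm
  have h1 := congrArg (fun T : K →L[ℂ] K => ⟪s w, T w⟫) h
  simp only [mul_def, comp_apply, add_apply, sub_apply, smul_apply, star_eq_adjoint, inner_add_right,
    inner_sub_right, inner_smul_right, adjoint_inner_right, inner_self_eq_norm_sq_to_K] at h1
  rw [hsym (s w) (s (s w)), inner_self_eq_norm_sq_to_K] at h1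
  have h2 : ‖u (s w)‖ ^ 2 + ‖v (s w)‖ ^ 2 = ε * ‖s w‖ ^ 2 - ‖s (s w)‖ ^ 2 :=
    Complex.ofReal_injective (by push_cast; exact h1)
  nlinarith [sq_nonneg ‖s (s w)‖]

/-- Quantitative form: for every `ε > 0` there is a unit vector which is an `ε`-approximate
joint eigenvector. -/
theorem exists_unit_approximate_eigvec_of_character
    (A : StarSubalgebra ℂ (K →L[ℂ] K)) (hAclosed : IsClosed (A : Set (K →L[ℂ] K)))
    (hAcomm : ∀ a b : A, a * b = b * a)
    (x : K) (hx : DenseRange fun a : A => (a : K →L[ℂ] K) x)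
    (φ : A →ₐ[ℂ] ℂ) (a₁ a₂ : A) {ε : ℝ} (hε : 0 < ε) :
    ∃ y : K, ‖y‖ = 1 ∧ ⟪x, y⟫ ≠ 0 ∧ ∀ a ∈ ({a₁, a₂} : Set A),
      ‖(a : K →L[ℂ] K) y - φ a • y‖ ≤ ε ∧
      ‖⟪x, (a : K →L[ℂ] K) y⟫ / ⟪x, y⟫ - φ a‖ ≤ ε := by
  have : IsClosed (A : Set (K →L[ℂ] K)) := hAclosed
  set u : A → A := fun a => a - φ a • 1
  have hu : ∀ a, φ (u a) = 0 := fun a => by simp [u]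
  obtain ⟨s, hs, hφs, hloc⟩ :=
    φ.exists_isSelfAdjoint_localizer (hu a₁) (hu a₂) (pow_pos hε 2)
  have hS : IsSelfAdjoint (s : K →L[ℂ] K) := congrArg Subtype.val hs
  have hsym : ∀ a b : K, ⟪a, (s : K →L[ℂ] K) b⟫ = ⟪(s : K →L[ℂ] K) a, b⟫ :=
    fun a b => (hS.isSymmetric a b).symm
  have hsq := norm_sq_add_norm_sq_le_of_localizer (u := (u a₁ : K →L[ℂ] K))
    (v := (u a₂ : K →L[ℂ] K)) hS (ε := ε ^ 2) (by simpa using congrArg Subtype.val hloc)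
  have hbound : ∀ a ∈ ({a₁, a₂} : Set A), ∀ w : K,
      ‖(u a : K →L[ℂ] K) ((s : K →L[ℂ] K) w)‖ ≤ ε * ‖(s : K →L[ℂ] K) w‖ := by
    intro a ha w
    refine le_of_sq_le_sq ?_ (by positivity)
    rw [mul_pow]
    rcases ha with rfl | rfl
    · nlinarith [hsq w, sq_nonneg ‖(u a₂ : K →L[ℂ] K) ((s : K →L[ℂ] K) w)‖]
    · nlinarith [hsq w, sq_nonneg ‖(u a₁ : K →L[ℂ] K) ((s : K →L[ℂ] K) w)‖]
  have hu_apply : ∀ a z, (u a : K →L[ℂ] K) z = (a : K →L[ℂ] K) z - φ a • z := by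
    intro a z; simp [u]
  have hcomm : ∀ (a b : A) (w : K), (a : K →L[ℂ] K) ((b : K →L[ℂ] K) w) =
      (b : K →L[ℂ] K) ((a : K →L[ℂ] K) w) := fun a b w =>
    congrArg (fun T : A => (T : K →L[ℂ] K) w) (hAcomm a b)
  set z := (s : K →L[ℂ] K) x with hz
  have hz0 : z ≠ 0 := by
    intro h0
    have : (fun w => (s : K →L[ℂ] K) w) = fun _ => 0 :=
      hx.equalizer (s : K →L[ℂ] K).continuous continuous_const
        (funext fun a => by simp [hcomm s a x, ← hz, h0])
    have hs0 : s = 0 := Subtype.ext (ContinuousLinearMap.ext fun w => congrFun this w)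
    simp [hs0] at hφs
  set y := (s : K →L[ℂ] K) z with hy
  have hxy : ⟪x, y⟫ = (‖z‖ ^ 2 : ℝ) := by
    rw [hy, hsym, ← hz, inner_self_eq_norm_sq_to_K]; norm_cast
  have hzn : 0 < ‖z‖ := norm_pos_iff.2 hz0
  have hxy0 : ⟪x, y⟫ ≠ 0 := by
    rw [hxy]; exact_mod_cast (pow_pos hzn 2).ne'
  have hy0 : y ≠ 0 := fun h => hxy0 (by rw [h, inner_zero_right])
  have hyn : 0 < ‖y‖ := norm_pos_iff.2 hy0
  have hc0 : ((‖y‖⁻¹ : ℝ) : ℂ) ≠ 0 := by exact_mod_cast (inv_pos.2 hyn).ne'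
  have hcn : ‖((‖y‖⁻¹ : ℝ) : ℂ)‖ = ‖y‖⁻¹ := by simp
  refine ⟨((‖y‖⁻¹ : ℝ) : ℂ) • y, ?_, ?_, fun a ha => ⟨?_, ?_⟩⟩
  · rw [norm_smul, hcn, inv_mul_cancel₀ hyn.ne']
  · rw [inner_smul_right]
    exact mul_ne_zero hc0 hxy0
  · rw [map_smul, smul_comm, ← smul_sub, ← hu_apply, norm_smul, hcn, inv_mul_le_iff₀ hyn,
      mul_comm]
    exact hbound a ha z
  · rw [map_smul, inner_smul_right, inner_smul_right, mul_div_mul_left _ _ hc0]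
    have h1 : ⟪x, (a : K →L[ℂ] K) y⟫ / ⟪x, y⟫ - φ a = ⟪z, (u a : K →L[ℂ] K) z⟫ / ⟪x, y⟫ := by
      rw [hz, ← hsym, ← hz, hcomm s (u a) z, ← hy, hu_apply, inner_sub_right, inner_smul_right,
        sub_div, mul_div_cancel_right₀ _ hxy0]
    rw [h1, norm_div, hxy, Complex.norm_real, Real.norm_of_nonneg (by positivity),
      div_le_iff₀ (by positivity)]
    calc ‖⟪z, (u a : K →L[ℂ] K) z⟫‖ ≤ ‖z‖ * ‖(u a : K →L[ℂ] K) z‖ := norm_inner_le_norm _ _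
      _ ≤ ‖z‖ * (ε * ‖z‖) := by gcongr; exact hbound a ha x
      _ = ε * ‖z‖ ^ 2 := by ring

end

/-- for a commutative unital C*-subalgebra `A` of `B(K)` with a cyclic vector
`x`, any character `lam` of `A` and any `a₁, a₂ ∈ A`, there exists a sequence `(x_l)` in `K`
with `⟨x_l, x⟩ ≠ 0` such that `aᵢ x_l − lam aᵢ • x_l → 0` and
`⟨aᵢ x_l, x⟩ / ⟨x_l, x⟩ → lam aᵢ` for `i = 1, 2`.  (The paper's inner product `⟨·,·⟩` is
linear in its first argument, i.e. `⟨a, b⟩ = ⟪b, a⟫` in Mathlib's convention.) -/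
theorem approximate_eigvecs_of_character
    {K : Type*} [NormedAddCommGroup K] [InnerProductSpace ℂ K] [CompleteSpace K]
    (A : StarSubalgebra ℂ (K →L[ℂ] K)) (hAclosed : IsClosed (A : Set (K →L[ℂ] K)))
    (hAcomm : ∀ a b : A, a * b = b * a)
    (x : K) (hx : DenseRange fun a : A => (a : K →L[ℂ] K) x)
    (lam : A →ₗ[ℂ] ℂ) (hmul : ∀ a b : A, lam (a * b) = lam a * lam b) (hne : lam ≠ 0)
    (a₁ a₂ : A) :
    ∃ xl : ℕ → K,
      (∀ l : ℕ, ⟪x, xl l⟫ ≠ 0) ∧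
      Tendsto (fun l => (a₁ : K →L[ℂ] K) (xl l) - lam a₁ • xl l) atTop (𝓝 0) ∧
      Tendsto (fun l => (a₂ : K →L[ℂ] K) (xl l) - lam a₂ • xl l) atTop (𝓝 0) ∧
      Tendsto (fun l => ⟪x, (a₁ : K →L[ℂ] K) (xl l)⟫ / ⟪x, xl l⟫) atTop (𝓝 (lam a₁)) ∧
      Tendsto (fun l => ⟪x, (a₂ : K →L[ℂ] K) (xl l)⟫ / ⟪x, xl l⟫) atTop (𝓝 (lam a₂)) := by
  have h1 : lam 1 = 1 := by
    obtain ⟨a, ha⟩ : ∃ a, lam a ≠ 0 := by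
      by_contra! h
      exact hne (LinearMap.ext h)
    exact mul_left_cancel₀ ha (by rw [← hmul, mul_one, mul_one])
  have hex := fun l : ℕ => exists_unit_approximate_eigvec_of_character A hAclosed hAcomm x hx
    (AlgHom.ofLinearMap lam h1 hmul) a₁ a₂ (Nat.one_div_pos_of_nat (α := ℝ) (n := l))
  choose y _ hy0 hy using hex
  have hlim := tendsto_one_div_add_atTop_nhds_zero_nat (𝕜 := ℝ)
  refine ⟨y, hy0, ?_, ?_, ?_, ?_⟩
  · exact squeeze_zero_norm (fun l => (hy l a₁ (by simp)).1) hlim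
  · exact squeeze_zero_norm (fun l => (hy l a₂ (by simp)).1) hlim
  · exact tendsto_sub_nhds_zero_iff.1
      (squeeze_zero_norm (fun l => (hy l a₁ (by simp)).2) hlim)
  · exact tendsto_sub_nhds_zero_iff.1
      (squeeze_zero_norm (fun l => (hy l a₂ (by simp)).2) hlim)
end

section
/- Let T be an injective half-centered bounded linear operator on a complex Hilbert space H, and let A be the norm-closed unital star subalgebra of the bounded operators on H generated by {T_k : k ∈ ℕ} (commutative since T is half-centered). If γ is a character of A (a nonzero multiplicative linear functional on A) and γ(T_k) = 0 for some k ∈ ℕ, then γ(T_{k+j}) = 0 for every j ∈ ℕ. -/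
open ContinuousLinearMap

variable {H : Type*} [NormedAddCommGroup H] [InnerProductSpace ℂ H] [CompleteSpace H]

theorem opT_eq_star_mul (T : H →L[ℂ] H) (n : ℕ) : opT T n = star (T ^ n) * T ^ n := rfl

theorem opT_nonneg (T : H →L[ℂ] H) (n : ℕ) : 0 ≤ opT T n := star_mul_self_nonneg _

theorem opT_add_eq (T : H →L[ℂ] H) (k j : ℕ) :
    opT T (k + j) = star (T ^ k) * opT T j * T ^ k := by
  rw [opT_eq_star_mul, opT_eq_star_mul, add_comm k j, pow_add, star_mul]
  simp only [mul_assoc]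

theorem opT_add_le (T : H →L[ℂ] H) (k j : ℕ) :
    opT T (k + j) ≤ ‖opT T j‖ • opT T k := by
  rw [opT_add_eq, opT_eq_star_mul T k]
  exact CStarAlgebra.star_left_conjugate_le_norm_smul (IsSelfAdjoint.of_nonneg (opT_nonneg T j))

open scoped ComplexOrder in
/-- Characters of a closed star subalgebra take nonnegative values on positive operators. -/
theorem StarSubalgebra.algHom_apply_nonneg {A : StarSubalgebra ℂ (H →L[ℂ] H)}
    (hA : IsClosed (A : Set (H →L[ℂ] H))) (φ : A →ₐ[ℂ] ℂ) (a : A)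
    (ha : 0 ≤ (a : H →L[ℂ] H)) : 0 ≤ φ a := by
  have hmem := AlgHom.apply_mem_spectrum φ a
  rw [StarSubalgebra.spectrum_eq (hS := hA)] at hmem
  exact spectrum_nonneg_of_nonneg ha hmem

/-- let `A` be the norm-closed unital star subalgebra of `B(H)` generated by
the operators `T_k`.  If a character `γ` of `A` satisfies `γ (T_k) = 0` for some `k`, then
`γ (T_{k+j}) = 0` for all `j`. -/
theorem character_zero_propagates (T : H →L[ℂ] H) (hinj : Function.Injective T)
    (hT : IsHalfCentered T)
    (A : StarSubalgebra ℂ (H →L[ℂ] H))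
    (hA : A = (StarAlgebra.adjoin ℂ (Set.range (opT T))).topologicalClosure)
    (hmem : ∀ n : ℕ, opT T n ∈ A)
    (γ : A →ₗ[ℂ] ℂ) (hγMul : ∀ a b : A, γ (a * b) = γ a * γ b) (hγ0 : γ ≠ 0)
    (k : ℕ) (hk : γ ⟨opT T k, hmem k⟩ = 0) :
    ∀ j : ℕ, γ ⟨opT T (k + j), hmem (k + j)⟩ = 0 := by
  intro j
  have hclosed : IsClosed (A : Set (H →L[ℂ] H)) := by
    rw [hA]
    exact StarSubalgebra.isClosed_topologicalClosure _
  have hone : γ 1 = 1 := by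
    obtain ⟨a, ha⟩ := DFunLike.ne_iff.mp hγ0
    exact mul_left_cancel₀ ha (by rw [← hγMul, mul_one, mul_one])
  let φ : A →ₐ[ℂ] ℂ := AlgHom.ofLinearMap γ hone hγMul
  have hlower := StarSubalgebra.algHom_apply_nonneg hclosed φ ⟨_, hmem (k + j)⟩
    (opT_nonneg T (k + j))
  have hupper := StarSubalgebra.algHom_apply_nonneg hclosed φ
    ((‖opT T j‖ : ℂ) • ⟨_, hmem k⟩ - ⟨_, hmem (k + j)⟩)
    (sub_nonneg.mpr (by exact_mod_cast opT_add_le T k j))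
  have hφ : φ ⟨_, hmem k⟩ = 0 := hk
  rw [map_sub, map_smul, hφ, smul_zero, zero_sub] at hupper
  open scoped ComplexOrder in
  exact le_antisymm (neg_nonneg.mp hupper) hlower
end
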